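/- Let n ≥ 1 and let S ⊆ ℤⁿ have the line property. Then there exist a real number ε > 0 and a natural number k₀ such that for every integer k ≥ k₀: if |S ∩ [−k,k]ⁿ| ≥ ε·(2k+1)ⁿ, then [−k,k]ⁿ ⊆ S. -/

import Mathlib

/-- A set of lattice points has the line property if it contains every axis-parallel line
meeting it in two points. -/
def HasLineProperty {n : ℕ} (S : Set (Fin n → ℤ)) : Prop :=
  ∀ (x : Fin n → ℤ) (j : Fin n) (a b : ℤ), a ≠ b →
    Function.update x j a ∈ S → Function.update x j b ∈ S → ∀ t : ℤ, Function.update x j t ∈ S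

/-- The lattice points of the cube `[-k, k]ⁿ`. -/
def latticeCube (n k : ℕ) : Set (Fin n → ℤ) := {x | ∀ i, |x i| ≤ (k : ℤ)}

/-- The slice of a set of lattice points on which the first coordinate equals `t`. -/
def latticeSlice {n : ℕ} (S : Set (Fin (n + 1) → ℤ)) (t : ℤ) : Set (Fin n → ℤ) :=
  {y | (Fin.cons t y : Fin (n + 1) → ℤ) ∈ S}

theorem latticeCube_eq_piFinset (n k : ℕ) :
    latticeCube n k =
      (Fintype.piFinset fun _ : Fin n => Finset.Icc (-(k : ℤ)) k : Finset (Fin n → ℤ)) := by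
  ext x
  simp [latticeCube, abs_le, Pi.le_def, forall_and]

theorem finite_latticeCube (n k : ℕ) : (latticeCube n k).Finite := by
  rw [latticeCube_eq_piFinset]
  exact Finset.finite_toSet _

theorem card_Icc_neg_self (k : ℕ) : (Finset.Icc (-(k : ℤ)) k).card = 2 * k + 1 := by
  rw [Int.card_Icc]
  omega

theorem ncard_latticeCube (n k : ℕ) : (latticeCube n k).ncard = (2 * k + 1) ^ n := by
  rw [latticeCube_eq_piFinset, Set.ncard_coe_finset, Fintype.card_piFinset]
  simp only [card_Icc_neg_self, Finset.prod_const, Finset.card_univ, Fintype.card_fin]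

theorem HasLineProperty.latticeSlice {n : ℕ} {S : Set (Fin (n + 1) → ℤ)}
    (hS : HasLineProperty S) (t : ℤ) : HasLineProperty (latticeSlice S t) := by
  intro x j a b hab ha hb s
  simp only [_root_.latticeSlice, Set.mem_ofPred_eq, Fin.cons_update] at ha hb ⊢
  exact hS _ _ a b hab ha hb s

/-- Two full slices force a set with the line property to be everything. -/
theorem HasLineProperty.eq_univ_of_latticeSlice {n : ℕ} {S : Set (Fin (n + 1) → ℤ)}
    (hS : HasLineProperty S) {a b : ℤ} (hab : a ≠ b) (ha : _root_.latticeSlice S a = Set.univ)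
    (hb : _root_.latticeSlice S b = Set.univ) : S = Set.univ := by
  refine Set.eq_univ_of_forall fun x => ?_
  have key (c : ℤ) (hc : _root_.latticeSlice S c = Set.univ) : Function.update x 0 c ∈ S := by
    have h : Fin.tail x ∈ _root_.latticeSlice S c := hc ▸ Set.mem_univ _
    rw [← Fin.cons_self_tail x, Fin.update_cons_zero]
    exact h
  simpa using hS x 0 a b hab (key a ha) (key b hb) (x 0)

theorem ncard_inter_latticeCube_le_sum {n : ℕ} (S : Set (Fin (n + 1) → ℤ)) (k : ℕ) :
    (S ∩ latticeCube (n + 1) k).ncard ≤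
      ∑ t ∈ Finset.Icc (-(k : ℤ)) k, (latticeSlice S t ∩ latticeCube n k).ncard := by
  have hfin (t : ℤ) : (latticeSlice S t ∩ latticeCube n k).Finite :=
    (finite_latticeCube n k).inter_of_right _
  have hsub : S ∩ latticeCube (n + 1) k ⊆ ⋃ t ∈ Finset.Icc (-(k : ℤ)) k,
      (fun y => (Fin.cons t y : Fin (n + 1) → ℤ)) '' (latticeSlice S t ∩ latticeCube n k) := by
    rintro x ⟨hxS, hx⟩
    simp only [Set.mem_iUnion]
    refine ⟨x 0, Finset.mem_Icc.2 (abs_le.1 (hx 0)), Fin.tail x, ⟨?_, fun i => hx i.succ⟩,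
      Fin.cons_self_tail x⟩
    change Fin.cons (x 0) (Fin.tail x) ∈ S
    rwa [Fin.cons_self_tail]
  refine (Set.ncard_le_ncard hsub ?_).trans ((Finset.set_ncard_biUnion_le _ _).trans ?_)
  · exact (Finset.finite_toSet _).biUnion fun t _ => (hfin t).image _
  · exact Finset.sum_le_sum fun t _ => Set.ncard_image_le (hfin t)

/-- A proper subset of `ℤⁿ` with the line property has at most `n (2k+1)ⁿ⁻¹` points in the cube
`[-k, k]ⁿ`. -/
theorem HasLineProperty.ncard_mul_le {n : ℕ} {S : Set (Fin n → ℤ)} (hS : HasLineProperty S)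
    (hne : S ≠ Set.univ) (k : ℕ) :
    (S ∩ latticeCube n k).ncard * (2 * k + 1) ≤ n * (2 * k + 1) ^ n := by
  induction n with
  | zero =>
    have h : S = ∅ := (Subsingleton.eq_univ_of_nonempty (s := S)).mt hne |>
      Set.not_nonempty_iff_eq_empty.1
    simp [h]
  | succ n ih =>
    obtain ⟨t₀, ht₀⟩ : ∃ t₀, ∀ t, t ≠ t₀ → _root_.latticeSlice S t ≠ Set.univ := by
      by_cases h : ∃ t, _root_.latticeSlice S t = Set.univ
      · obtain ⟨t₀, h₀⟩ := h
        exact ⟨t₀, fun t ht h => hne (hS.eq_univ_of_latticeSlice ht h h₀)⟩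
      · exact ⟨0, fun t _ ht => h ⟨t, ht⟩⟩
    have hslice (t : ℤ) : (_root_.latticeSlice S t ∩ latticeCube n k).ncard * (2 * k + 1) ≤
        n * (2 * k + 1) ^ n + if t = t₀ then (2 * k + 1) ^ (n + 1) else 0 := by
      split_ifs with h
      · have hle := Set.ncard_le_ncard
          (Set.inter_subset_right (s := _root_.latticeSlice S t)) (finite_latticeCube n k)
        rw [ncard_latticeCube] at hle
        exact (Nat.mul_le_mul_right _ hle).trans (Nat.le_add_left _ _)
      · exact ih (hS.latticeSlice t) (ht₀ t h)
    calc (S ∩ latticeCube (n + 1) k).ncard * (2 * k + 1)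
        ≤ ∑ t ∈ Finset.Icc (-(k : ℤ)) k,
            (_root_.latticeSlice S t ∩ latticeCube n k).ncard * (2 * k + 1) := by
          rw [← Finset.sum_mul]
          exact Nat.mul_le_mul_right _ (ncard_inter_latticeCube_le_sum S k)
      _ ≤ ∑ t ∈ Finset.Icc (-(k : ℤ)) k,
            (n * (2 * k + 1) ^ n + if t = t₀ then (2 * k + 1) ^ (n + 1) else 0) :=
          Finset.sum_le_sum fun t _ => hslice t
      _ ≤ (2 * k + 1) * (n * (2 * k + 1) ^ n) + (2 * k + 1) ^ (n + 1) := by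
          rw [Finset.sum_add_distrib, Finset.sum_const, card_Icc_neg_self, smul_eq_mul,
            Finset.sum_ite_eq']
          gcongr
          split_ifs <;> simp
      _ = (n + 1) * (2 * k + 1) ^ (n + 1) := by ring

/-- For every `ε > 0`, a set with the line property whose density in a sufficiently large cube is
at least `ε` is everything; how large the cube must be depends only on `n` and `ε`. -/
theorem HasLineProperty.eq_univ_of_density {n : ℕ} {S : Set (Fin n → ℤ)}
    (hS : HasLineProperty S) {ε : ℝ} {k : ℕ} (hk : (n : ℝ) < ε * (2 * k + 1))
    (hd : ε * (2 * (k : ℝ) + 1) ^ n ≤ ((S ∩ latticeCube n k).ncard : ℝ)) : S = Set.univ := by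
  by_contra hne
  have hbound : ((S ∩ latticeCube n k).ncard : ℝ) * (2 * k + 1) ≤ n * (2 * k + 1) ^ n := by
    exact_mod_cast hS.ncard_mul_le hne k
  have hpos : (0 : ℝ) < 2 * k + 1 := by positivity
  have hlt := mul_lt_mul_of_pos_right hk (pow_pos hpos n)
  have hle := mul_le_mul_of_nonneg_right hd hpos.le
  linarith [mul_right_comm ε (2 * (k : ℝ) + 1) ((2 * (k : ℝ) + 1) ^ n)]

/-- Let `n ≥ 1` and let `S ⊆ ℤⁿ` have the line property (whenever two points of
`S` differ only in one coordinate, the whole line through them in that coordinate direction is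
contained in `S`). Then there exist `ε > 0` and `k₀ ∈ ℕ` such that for every `k ≥ k₀`:
if `|S ∩ [−k,k]ⁿ| ≥ ε·(2k+1)ⁿ` then `[−k,k]ⁿ ⊆ S`. -/
theorem statement0 (n : ℕ) (hn : 1 ≤ n) (S : Set (Fin n → ℤ))
    (hS : ∀ (x : Fin n → ℤ) (j : Fin n) (a b : ℤ), a ≠ b →
      Function.update x j a ∈ S → Function.update x j b ∈ S →
      ∀ t : ℤ, Function.update x j t ∈ S) :
    ∃ ε : ℝ, 0 < ε ∧ ∃ k₀ : ℕ, ∀ k : ℕ, k₀ ≤ k →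
      ε * (2 * (k : ℝ) + 1) ^ n ≤
        ((S ∩ {x : Fin n → ℤ | ∀ i, |x i| ≤ (k : ℤ)}).ncard : ℝ) →
      {x : Fin n → ℤ | ∀ i, |x i| ≤ (k : ℤ)} ⊆ S := by
  refine ⟨1 / 2, by norm_num, n, fun k hk hd => ?_⟩
  have hk' : (n : ℝ) ≤ k := by exact_mod_cast hk
  have hS' : HasLineProperty S := hS
  rw [hS'.eq_univ_of_density (by linarith) hd]
  exact Set.subset_univ _
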